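/- The Hilbert system obtained by adding to the base logic all instances of the schema (RM_G) □_Gφ → □_G(φ∨ψ), for all finite nonempty G ⊆ I, is sound and strongly complete with respect to the class of all monotone models, i.e., models in which for all i ∈ I and all worlds w, N_i(w) is closed under supersets: if X ∈ N_i(w) and X ⊆ Y ⊆ W then Y ∈ N_i(w). -/

import Mathlib

attribute [local instance] Classical.propDecidable

/-- Formulas of the multi-modal language 𝔏: atoms, ⊥, ¬, ∨, and □_G for
finite nonempty G ⊆ I. -/
inductive Form (I : Type) : Type
  | atom : ℕ → Form I
  | bot  : Form I
  | neg  : Form I → Form I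
  | or   : Form I → Form I → Form I
  | box  : (G : Finset I) → G.Nonempty → Form I → Form I

namespace Form
variable {I : Type}
/-- φ ∧ ψ -/
def and (φ ψ : Form I) : Form I := .neg (.or (.neg φ) (.neg ψ))
/-- φ → ψ -/
def imp (φ ψ : Form I) : Form I := .or (.neg φ) ψ
/-- ⊤ -/
def top : Form I := .neg .bot
/-- φ ↔ ψ -/
def iff (φ ψ : Form I) : Form I := (φ.imp ψ).and (ψ.imp φ)
end Form

/-- The pointwise-intersection neighbourhood function:
`N_G(w) = { ⋂_{i∈G} X_i : X_i ∈ N_i(w) }`. -/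
def ptwInter {I W : Type} (N : I → W → Set (Set W)) (G : Finset I) (w : W) :
    Set (Set W) :=
  { X | ∃ Y : I → Set W, (∀ i ∈ G, Y i ∈ N i w) ∧ X = ⋂ i ∈ G, Y i }

/-- Satisfaction at a world, relative to neighbourhood functions `N` and a
valuation `V`. -/
def satN {I W : Type} (N : I → W → Set (Set W)) (V : ℕ → Set W) :
    Form I → W → Prop
  | .atom n, w => w ∈ V n
  | .bot, _ => False
  | .neg φ, w => ¬ satN N V φ w
  | .or φ ψ, w => satN N V φ w ∨ satN N V ψ w
  | .box G _ φ, w => { v | satN N V φ v } ∈ ptwInter N G w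

/-- A neighbourhood model. -/
structure NbhModel (I : Type) where
  W : Type
  ne : Nonempty W
  N : I → W → Set (Set W)
  V : ℕ → Set W

/-- Truth in a model. -/
def NbhModel.sat {I : Type} (M : NbhModel I) (w : M.W) (φ : Form I) : Prop :=
  satN M.N M.V φ w

/-- Propositional evaluation treating atoms and boxed formulas as atomic. -/
def evalP {I : Type} (v : Form I → Prop) : Form I → Prop
  | .atom n => v (.atom n)
  | .bot => False
  | .neg φ => ¬ evalP v φ
  | .or φ ψ => evalP v φ ∨ evalP v ψ
  | .box G h φ => v (.box G h φ)

/-- Classical propositional tautologies (in the extended modal language). -/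
def Tautology {I : Type} (φ : Form I) : Prop := ∀ v, evalP v φ

theorem unionNE {I : Type} [DecidableEq I] {G H : Finset I}
    (hG : G.Nonempty) : (G ∪ H).Nonempty :=
  hG.mono Finset.subset_union_left

/-- Axiom schema B1: `(□_Gφ ∧ □_Hψ) → □_{G∪H}(φ∧ψ)` for disjoint G, H. -/
def B1Ax (I : Type) [DecidableEq I] : Set (Form I) :=
  { χ | ∃ (G H : Finset I) (hG : G.Nonempty) (hH : H.Nonempty) (φ ψ : Form I),
      Disjoint G H ∧
      χ = ((Form.box G hG φ).and (Form.box H hH ψ)).imp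
            (Form.box (G ∪ H) (unionNE hG) (φ.and ψ)) }

/-- Axiom schema B2: `□_{G∪H}⊤ → □_G⊤`. -/
def B2Ax (I : Type) [DecidableEq I] : Set (Form I) :=
  { χ | ∃ (G H : Finset I) (hG : G.Nonempty) (_hH : H.Nonempty),
      χ = (Form.box (G ∪ H) (unionNE hG) Form.top).imp (Form.box G hG Form.top) }

/-- Axiom schema B3: `(□_Gφ ∧ □_{G∪H∪J}φ) → □_{G∪H}φ`. -/
def B3Ax (I : Type) [DecidableEq I] : Set (Form I) :=
  { χ | ∃ (G H J : Finset I) (hG : G.Nonempty) (_hH : H.Nonempty)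
      (_hJ : J.Nonempty) (φ : Form I),
      χ = ((Form.box G hG φ).and (Form.box (G ∪ H ∪ J) (unionNE (unionNE hG)) φ)).imp
            (Form.box (G ∪ H) (unionNE hG) φ) }

/-- Axiom schema B4: `(□_Gφ ∧ □_H(φ∨ψ)) → □_{G∪H}φ`. -/
def B4Ax (I : Type) [DecidableEq I] : Set (Form I) :=
  { χ | ∃ (G H : Finset I) (hG : G.Nonempty) (hH : H.Nonempty) (φ ψ : Form I),
      χ = ((Form.box G hG φ).and (Form.box H hH (φ.or ψ))).imp
            (Form.box (G ∪ H) (unionNE hG) φ) }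

/-- The axioms of the base logic. -/
def BaseAx (I : Type) [DecidableEq I] : Set (Form I) :=
  B1Ax I ∪ B2Ax I ∪ B3Ax I ∪ B4Ax I

/-- Hilbert-style provability from classical tautologies and the axioms in
`Ax`, closed under modus ponens and replacement of equivalents. -/
inductive Prv {I : Type} (Ax : Set (Form I)) : Form I → Prop
  | taut {φ : Form I} : Tautology φ → Prv Ax φ
  | ax {φ : Form I} : φ ∈ Ax → Prv Ax φ
  | mp {φ ψ : Form I} : Prv Ax (φ.imp ψ) → Prv Ax φ → Prv Ax ψ
  | re {φ ψ : Form I} (G : Finset I) (hG : G.Nonempty) :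
      Prv Ax (φ.iff ψ) → Prv Ax ((Form.box G hG φ).iff (Form.box G hG ψ))

/-- `Γ ⊢ φ` iff there are `ψ₁,…,ψₙ ∈ Γ` with `⊢ (ψ₁∧…∧ψₙ) → φ`. -/
def Deduces {I : Type} (Ax : Set (Form I)) (Γ : Set (Form I)) (φ : Form I) :
    Prop :=
  ∃ l : List (Form I), (∀ ψ ∈ l, ψ ∈ Γ) ∧
    Prv Ax ((l.foldr Form.and Form.top).imp φ)

/-- Semantic consequence over a class of models. -/
def SemConseq {I : Type} (C : NbhModel I → Prop) (Γ : Set (Form I))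
    (φ : Form I) : Prop :=
  ∀ M : NbhModel I, C M → ∀ w : M.W, (∀ ψ ∈ Γ, M.sat w ψ) → M.sat w φ

/-- Soundness and strong completeness of `Ax` w.r.t. the class `C`. -/
def SoundComplete {I : Type} (Ax : Set (Form I)) (C : NbhModel I → Prop) :
    Prop :=
  ∀ (Γ : Set (Form I)) (φ : Form I), Deduces Ax Γ φ ↔ SemConseq C Γ φ

/-- The schema (RM_G): □_Gφ → □_G(φ∨ψ) for all finite nonempty G ⊆ I. -/
def RMAx (I : Type) [DecidableEq I] : Set (Form I) :=
  { χ | ∃ (G : Finset I) (hG : G.Nonempty) (φ ψ : Form I),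
      χ = (Form.box G hG φ).imp (Form.box G hG (φ.or ψ)) }

namespace Form
variable {I : Type}

theorem evalP_and (v : Form I → Prop) (φ ψ : Form I) :
    evalP v (φ.and ψ) ↔ evalP v φ ∧ evalP v ψ := by
  simp only [Form.and, evalP]
  tauto

theorem evalP_imp (v : Form I → Prop) (φ ψ : Form I) :
    evalP v (φ.imp ψ) ↔ (evalP v φ → evalP v ψ) := by
  simp only [Form.imp, evalP]
  tauto

theorem evalP_top (v : Form I → Prop) : evalP v Form.top := by
  simp [Form.top, evalP]

theorem evalP_iff (v : Form I → Prop) (φ ψ : Form I) :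
    evalP v (φ.iff ψ) ↔ (evalP v φ ↔ evalP v ψ) := by
  simp only [Form.iff, evalP_and, evalP_imp]
  tauto

theorem evalP_foldr_and (v : Form I → Prop) (l : List (Form I)) :
    evalP v (l.foldr Form.and Form.top) ↔ ∀ ψ ∈ l, evalP v ψ := by
  induction l with
  | nil => simp [evalP_top]
  | cons a l ih => simp [evalP_and, ih]

end Form

section Soundness
variable {I W : Type} (N : I → W → Set (Set W)) (V : ℕ → Set W)

/-- Satisfaction at a world is the propositional evaluation it induces. -/
theorem evalP_satN (w : W) (φ : Form I) :
    evalP (fun χ => satN N V χ w) φ ↔ satN N V φ w := by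
  induction φ with
  | atom n => rfl
  | bot => rfl
  | neg φ ih => simp only [evalP, satN, ih]
  | or φ ψ ih₁ ih₂ => simp only [evalP, satN, ih₁, ih₂]
  | box G h φ => rfl

theorem satN_and (w : W) (φ ψ : Form I) :
    satN N V (φ.and ψ) w ↔ satN N V φ w ∧ satN N V ψ w := by
  simpa only [evalP_satN] using Form.evalP_and (fun χ => satN N V χ w) φ ψ

theorem satN_imp (w : W) (φ ψ : Form I) :
    satN N V (φ.imp ψ) w ↔ (satN N V φ w → satN N V ψ w) := by
  simpa only [evalP_satN] using Form.evalP_imp (fun χ => satN N V χ w) φ ψ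

theorem satN_iff (w : W) (φ ψ : Form I) :
    satN N V (φ.iff ψ) w ↔ (satN N V φ w ↔ satN N V ψ w) := by
  simpa only [evalP_satN] using Form.evalP_iff (fun χ => satN N V χ w) φ ψ

theorem satN_top (w : W) : satN N V (Form.top : Form I) w := by
  simpa only [evalP_satN] using Form.evalP_top (fun χ : Form I => satN N V χ w)

theorem satN_foldr_and (w : W) (l : List (Form I)) :
    satN N V (l.foldr Form.and Form.top) w ↔ ∀ ψ ∈ l, satN N V ψ w := by
  simpa only [evalP_satN] using Form.evalP_foldr_and (fun χ => satN N V χ w) l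

variable {N}

/-- Neighbourhoods of `G` and `H` can be pasted together, keeping those of `G` on the overlap. -/
theorem exists_ptwInter_union [DecidableEq I] {G H : Finset I} {w : W} {Y Z : I → Set W}
    (hY : ∀ i ∈ G, Y i ∈ N i w) (hZ : ∀ i ∈ H, Z i ∈ N i w) :
    ((⋂ i ∈ G, Y i) ∩ ⋂ i ∈ H \ G, Z i) ∈ ptwInter N (G ∪ H) w := by
  refine ⟨fun i => if i ∈ G then Y i else Z i, fun i hi => ?_, ?_⟩
  · by_cases h : i ∈ G
    · simpa [h] using hY i h
    · simpa [h] using hZ i ((Finset.mem_union.1 hi).resolve_left h)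
  · ext x
    simp only [Set.mem_inter_iff, Set.mem_iInter, Finset.mem_union, Finset.mem_sdiff]
    constructor
    · rintro ⟨h₁, h₂⟩ i hi
      by_cases h : i ∈ G
      · simpa [h] using h₁ i h
      · simpa [h] using h₂ i ⟨hi.resolve_left h, h⟩
    · intro h
      exact ⟨fun i hi => by simpa [hi] using h i (.inl hi),
        fun i hi => by simpa [hi.2] using h i (.inr hi.1)⟩

theorem inter_mem_ptwInter_union [DecidableEq I] {G H : Finset I} {w : W} {A B : Set W}
    (hd : Disjoint G H) (hA : A ∈ ptwInter N G w) (hB : B ∈ ptwInter N H w) :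
    A ∩ B ∈ ptwInter N (G ∪ H) w := by
  obtain ⟨Y, hY, rfl⟩ := hA
  obtain ⟨Z, hZ, rfl⟩ := hB
  have := exists_ptwInter_union hY hZ
  rwa [Finset.sdiff_eq_self_of_disjoint hd.symm] at this

theorem mem_ptwInter_union_of_subset [DecidableEq I] {G H : Finset I} {w : W} {A B : Set W}
    (hAB : A ⊆ B) (hA : A ∈ ptwInter N G w) (hB : B ∈ ptwInter N H w) :
    A ∈ ptwInter N (G ∪ H) w := by
  obtain ⟨Y, hY, rfl⟩ := hA
  obtain ⟨Z, hZ, rfl⟩ := hB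
  have h := exists_ptwInter_union hY hZ
  rwa [Set.inter_eq_left.2] at h
  exact hAB.trans (Set.biInter_subset_biInter_left fun i hi => (Finset.mem_sdiff.1 hi).1)

theorem univ_mem_ptwInter_mono {G H : Finset I} {w : W} (hGH : G ⊆ H)
    (h : Set.univ ∈ ptwInter N H w) : Set.univ ∈ ptwInter N G w := by
  obtain ⟨Y, hY, hU⟩ := h
  refine ⟨Y, fun i hi => hY i (hGH hi), ?_⟩
  exact (Set.univ_subset_iff.1
    (hU.subset.trans (Set.biInter_subset_biInter_left fun i hi => hGH hi))).symm

theorem mem_ptwInter_of_subset_of_subset [DecidableEq I] {G H K : Finset I} {w : W} {A : Set W}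
    (hHK : H ⊆ K) (hG : A ∈ ptwInter N G w) (hK : A ∈ ptwInter N K w) :
    A ∈ ptwInter N (G ∪ H) w := by
  obtain ⟨Z, hZ, hA⟩ := hK
  exact mem_ptwInter_union_of_subset
    (hA.subset.trans (Set.biInter_subset_biInter_left fun i hi => hHK hi)) hG
    ⟨Z, fun i hi => hZ i (hHK hi), rfl⟩

theorem ptwInter_mono_of_monotone (hN : ∀ i w X Y, X ∈ N i w → X ⊆ Y → Y ∈ N i w)
    {G : Finset I} {w : W} {A B : Set W} (hAB : A ⊆ B) (hA : A ∈ ptwInter N G w) :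
    B ∈ ptwInter N G w := by
  obtain ⟨Y, hY, rfl⟩ := hA
  refine ⟨fun i => Y i ∪ B, fun i hi => hN i w _ _ (hY i hi) Set.subset_union_left, ?_⟩
  ext x
  simp only [Set.mem_iInter, Set.mem_union]
  refine ⟨fun h _ _ => .inr h, fun h => ?_⟩
  by_contra hx
  exact hx (hAB (Set.mem_iInter₂.2 fun i hi => (h i hi).resolve_right hx))

theorem satN_of_prv [DecidableEq I] (hN : ∀ i w X Y, X ∈ N i w → X ⊆ Y → Y ∈ N i w)
    {φ : Form I} (h : Prv (BaseAx I ∪ RMAx I) φ) (w : W) : satN N V φ w := by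
  induction h generalizing w with
  | taut h => exact (evalP_satN N V w _).1 (h _)
  | mp _ _ ih₁ ih₂ => exact (satN_imp N V w _ _).1 (ih₁ w) (ih₂ w)
  | re G hG _ ih =>
    rw [satN_iff]
    simp only [satN, fun v => (satN_iff N V v _ _).1 (ih v)]
  | ax h =>
    rcases h with (((h | h) | h) | h) | h
    · obtain ⟨G, H, hG, hH, φ, ψ, hd, rfl⟩ := h
      rw [satN_imp, satN_and]
      rintro ⟨h₁, h₂⟩
      simp only [satN, satN_and] at *
      exact inter_mem_ptwInter_union hd h₁ h₂
    · obtain ⟨G, H, hG, hH, rfl⟩ := h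
      rw [satN_imp]
      simp only [satN, satN_top, Set.ofPred_true]
      exact univ_mem_ptwInter_mono Finset.subset_union_left
    · obtain ⟨G, H, J, hG, hH, hJ, φ, rfl⟩ := h
      rw [satN_imp, satN_and]
      rintro ⟨h₁, h₂⟩
      exact mem_ptwInter_of_subset_of_subset
        (Finset.subset_union_right.trans Finset.subset_union_left) h₁ h₂
    · obtain ⟨G, H, hG, hH, φ, ψ, rfl⟩ := h
      rw [satN_imp, satN_and]
      rintro ⟨h₁, h₂⟩
      exact mem_ptwInter_union_of_subset (fun v hv => Or.inl hv) h₁ h₂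
    · obtain ⟨G, hG, φ, ψ, rfl⟩ := h
      rw [satN_imp]
      exact ptwInter_mono_of_monotone hN fun v hv => Or.inl hv

end Soundness

section Lindenbaum
variable {I : Type} {Ax : Set (Form I)}

/-- The propositional valuations satisfying every theorem of the logic. They play the role of the
maximal consistent sets. -/
def TheoryVal (Ax : Set (Form I)) : Type :=
  { v : Form I → Prop // ∀ φ, Prv Ax φ → evalP v φ }

/-- The filter of sets of valuations generated by `Γ`, the theorems of the logic, and `¬φ`. -/
def lindenbaumFilter (Ax Γ : Set (Form I)) (φ : Form I) : Filter (Form I → Prop) where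
  sets := { S | ∃ (l : List (Form I)) (θ : Form I), (∀ ψ ∈ l, ψ ∈ Γ) ∧ Prv Ax θ ∧
    ∀ v, (∀ ψ ∈ l, evalP v ψ) → evalP v θ → ¬ evalP v φ → v ∈ S }
  univ_sets := ⟨[], .top, by simp, .taut Form.evalP_top, by simp⟩
  sets_of_superset := by
    rintro S T ⟨l, θ, hl, hθ, h⟩ hST
    exact ⟨l, θ, hl, hθ, fun v h₁ h₂ h₃ => hST (h v h₁ h₂ h₃)⟩
  inter_sets := by
    rintro S T ⟨l, θ, hl, hθ, h⟩ ⟨l', θ', hl', hθ', h'⟩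
    refine ⟨l ++ l', θ.and θ', ?_, ?_, ?_⟩
    · simp only [List.mem_append]
      rintro ψ (hψ | hψ)
      exacts [hl ψ hψ, hl' ψ hψ]
    · refine .mp (.mp (.taut fun v => ?_) hθ) hθ'
      simp only [Form.evalP_imp, Form.evalP_and]
      tauto
    · intro v h₁ h₂ h₃
      rw [Form.evalP_and] at h₂
      exact ⟨h v (fun ψ hψ => h₁ ψ (by simp [hψ])) h₂.1 h₃,
        h' v (fun ψ hψ => h₁ ψ (by simp [hψ])) h₂.2 h₃⟩

theorem lindenbaumFilter_neBot {Γ : Set (Form I)} {φ : Form I} (h : ¬ Deduces Ax Γ φ) :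
    (lindenbaumFilter Ax Γ φ).NeBot := by
  rw [← Filter.empty_mem_iff_bot.not.trans Filter.neBot_iff.symm]
  rintro ⟨l, θ, hl, hθ, hv⟩
  refine h ⟨l, hl, .mp (.taut fun v => ?_) hθ⟩
  simp only [Form.evalP_imp, Form.evalP_foldr_and]
  intro h₁ h₂
  by_contra h₃
  exact hv v h₂ h₁ h₃

theorem evalP_eventually (U : Ultrafilter (Form I → Prop)) (φ : Form I) :
    evalP (fun χ => ∀ᶠ v : Form I → Prop in U, v χ) φ ↔ ∀ᶠ v in U, evalP v φ := by
  induction φ with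
  | atom n => rfl
  | bot => simp [evalP, U.neBot.ne]
  | neg φ ih => simp only [evalP, ih, Ultrafilter.eventually_not]
  | or φ ψ ih₁ ih₂ => simp only [evalP, ih₁, ih₂, Ultrafilter.eventually_or]
  | box G h φ => rfl

theorem exists_theoryVal {Γ : Set (Form I)} {φ : Form I} (h : ¬ Deduces Ax Γ φ) :
    ∃ v : TheoryVal Ax, (∀ ψ ∈ Γ, evalP v.1 ψ) ∧ ¬ evalP v.1 φ := by
  have := lindenbaumFilter_neBot h
  let U := Ultrafilter.of (lindenbaumFilter Ax Γ φ)
  have hU : (U : Filter (Form I → Prop)) ≤ lindenbaumFilter Ax Γ φ := Ultrafilter.of_le _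
  refine ⟨⟨fun χ => ∀ᶠ v : Form I → Prop in U, v χ, fun ψ hψ => ?_⟩, fun ψ hψ => ?_, ?_⟩
  · rw [evalP_eventually]
    exact hU ⟨[], ψ, by simp, hψ, fun v _ h _ => h⟩
  · rw [evalP_eventually]
    exact hU ⟨[ψ], .top, by simpa, .taut Form.evalP_top, fun v h _ _ => h ψ (by simp)⟩
  · rw [evalP_eventually, ← Ultrafilter.eventually_not]
    exact hU ⟨[], .top, by simp, .taut Form.evalP_top, fun v _ _ h => h⟩

theorem prv_of_forall_theoryVal {φ : Form I} (h : ∀ v : TheoryVal Ax, evalP v.1 φ) :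
    Prv Ax φ := by
  by_contra hφ
  obtain ⟨v, -, hv⟩ := exists_theoryVal (Ax := Ax) (Γ := ∅) (φ := φ) (by
    rintro ⟨l, hl, hp⟩
    obtain rfl : l = [] := List.eq_nil_iff_forall_not_mem.2 hl
    exact hφ (hp.mp (.taut Form.evalP_top)))
  exact hv (h v)

end Lindenbaum

section Canonical
variable {I : Type} [DecidableEq I]

/-- The valuations corresponding to the maximal consistent sets of the monotone logic. -/
abbrev RMVal (I : Type) [DecidableEq I] : Type := TheoryVal (BaseAx I ∪ RMAx I)

namespace RMVal

theorem box_mono (v : RMVal I) {G : Finset I} {hG : G.Nonempty} {φ ψ : Form I}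
    (h : ∀ u : RMVal I, evalP u.1 φ → evalP u.1 ψ) (hφ : v.1 (.box G hG φ)) :
    v.1 (.box G hG ψ) := by
  have h₁ := v.2 _ (.ax (.inr ⟨G, hG, φ, ψ, rfl⟩))
  have h₂ := v.2 _ (.re G hG (prv_of_forall_theoryVal (φ := (φ.or ψ).iff ψ) fun u => by
    have := h u
    rw [Form.evalP_iff]
    simp only [evalP]
    tauto))
  rw [Form.evalP_imp] at h₁
  rw [Form.evalP_iff] at h₂
  exact h₂.1 (h₁ hφ)

theorem box_union (v : RMVal I) {G H : Finset I} {hG : G.Nonempty} {hH : H.Nonempty}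
    {φ ψ : Form I} (hd : Disjoint G H) (hφ : v.1 (.box G hG φ)) (hψ : v.1 (.box H hH ψ)) :
    v.1 (.box (G ∪ H) (unionNE hG) (φ.and ψ)) := by
  have h := v.2 _ (.ax (.inl (.inl (.inl (.inl ⟨G, H, hG, hH, φ, ψ, hd, rfl⟩)))))
  rw [Form.evalP_imp, Form.evalP_and] at h
  exact h ⟨hφ, hψ⟩

theorem box_top_of_subset (v : RMVal I) {G H : Finset I} {hG : G.Nonempty} {hH : H.Nonempty}
    (hGH : G ⊆ H) (h : v.1 (.box H hH .top)) : v.1 (.box G hG .top) := by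
  have h₂ := v.2 _ (.ax (.inl (.inl (.inl (.inr ⟨G, H, hG, hH, rfl⟩)))))
  rw [Form.evalP_imp] at h₂
  refine h₂ ?_
  simp only [Finset.union_eq_right.2 hGH]
  exact h

/-- `□_G φ` holds at `v`, where `□_∅ φ` is read as validity of `φ`. -/
def HoldsBox (v : RMVal I) (G : Finset I) (φ : Form I) : Prop :=
  (∃ hG : G.Nonempty, v.1 (.box G hG φ)) ∨ (G = ∅ ∧ ∀ u : RMVal I, evalP u.1 φ)

theorem HoldsBox.union {v : RMVal I} {G H : Finset I} {φ ψ : Form I} (hd : Disjoint G H)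
    (hφ : v.HoldsBox G φ) (hψ : v.HoldsBox H ψ) : v.HoldsBox (G ∪ H) (φ.and ψ) := by
  rcases hφ with ⟨hG, hφ⟩ | ⟨rfl, hφ⟩ <;> rcases hψ with ⟨hH, hψ⟩ | ⟨rfl, hψ⟩
  · exact .inl ⟨unionNE hG, box_union v hd hφ hψ⟩
  · rw [Finset.union_empty]
    exact .inl ⟨hG, box_mono v (fun u hu => (Form.evalP_and _ _ _).2 ⟨hu, hψ u⟩) hφ⟩
  · rw [Finset.empty_union]
    exact .inl ⟨hH, box_mono v (fun u hu => (Form.evalP_and _ _ _).2 ⟨hφ u, hu⟩) hψ⟩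
  · exact .inr ⟨by simp, fun u => (Form.evalP_and _ _ _).2 ⟨hφ u, hψ u⟩⟩

theorem HoldsBox.exists_biUnion {Q : Type} {v : RMVal I} {F : Q → Finset I} {θ : Q → Form I}
    (hF : Pairwise fun p q => Disjoint (F p) (F q)) (S : Finset Q)
    (h : ∀ q ∈ S, v.HoldsBox (F q) (θ q)) :
    ∃ χ, v.HoldsBox (S.biUnion F) χ ∧
      ∀ u : RMVal I, evalP u.1 χ → ∀ q ∈ S, evalP u.1 (θ q) := by
  induction S using Finset.induction_on with
  | empty => exact ⟨.top, .inr ⟨by simp, fun u => Form.evalP_top _⟩, by simp⟩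
  | insert q S hq ih =>
    obtain ⟨χ, hχ, hS⟩ := ih fun p hp => h p (Finset.mem_insert_of_mem hp)
    refine ⟨(θ q).and χ, ?_, fun u hu p hp => ?_⟩
    · rw [Finset.biUnion_insert]
      refine (h q (Finset.mem_insert_self q S)).union ?_ hχ
      exact (Finset.disjoint_biUnion_right _ _ _).2 fun p hp => hF fun e => hq (e ▸ hp)
    · rw [Form.evalP_and] at hu
      rcases Finset.mem_insert.1 hp with rfl | hp
      exacts [hu.1, hS u hu.2 p hp]

end RMVal

/-- Pairs `(G, φ)` indexing the formulas `□_G φ`. -/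
abbrev BoxIndex (I : Type) : Type := { G : Finset I // G.Nonempty } × Form I

/-- Worlds of the canonical model: a valuation together with a choice of one agent in `G` for
every formula `□_G φ`. -/
abbrev CanonicalWorld (I : Type) [DecidableEq I] : Type :=
  RMVal I × ∀ q : BoxIndex I, { i // i ∈ q.1.1 }

/-- The contribution of agent `i` to the formula `□_G φ`. -/
def contribution (q : BoxIndex I) (i : I) : Set (CanonicalWorld I) :=
  { w | (w.2 q : I) = i → evalP w.1.1 q.2 }

/-- Canonical neighbourhoods: the supersets of the contributions of `i` to true boxes. -/
def canonicalNbhd (i : I) (w : CanonicalWorld I) : Set (Set (CanonicalWorld I)) :=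
  { Y | ∃ q : BoxIndex I, i ∈ q.1.1 ∧ w.1.1 (.box q.1.1 q.1.2 q.2) ∧ contribution q i ⊆ Y }

/-- The canonical valuation of atoms. -/
def canonicalVal (n : ℕ) : Set (CanonicalWorld I) := { w | w.1.1 (.atom n) }

theorem iInter_contribution (q : BoxIndex I) :
    ⋂ i ∈ q.1.1, contribution q i = { w | evalP w.1.1 q.2 } := by
  ext w
  simp only [Set.mem_iInter, contribution, Set.mem_ofPred_eq]
  exact ⟨fun h => h _ (w.2 q).2 rfl, fun h _ _ _ => h⟩

theorem box_of_mem_ptwInter {w : CanonicalWorld I} {H : Finset I} (hH : H.Nonempty)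
    {ψ : Form I} (h : { u : CanonicalWorld I | evalP u.1.1 ψ } ∈ ptwInter canonicalNbhd H w) :
    w.1.1 (.box H hH ψ) := by
  obtain ⟨Y, hY, hψ⟩ := h
  have hex : ∀ i, ∃ q : BoxIndex I, i ∈ H →
      i ∈ q.1.1 ∧ w.1.1 (.box q.1.1 q.1.2 q.2) ∧ contribution q i ⊆ Y i := by
    intro i
    by_cases hi : i ∈ H
    · obtain ⟨q, hq⟩ := hY i hi
      exact ⟨q, fun _ => hq⟩
    · exact ⟨(⟨{i}, by simp⟩, .top), fun h => (hi h).elim⟩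
  choose p hp using hex
  let F : BoxIndex I → Finset I := fun q => {i ∈ H | p i = q}
  let θ : BoxIndex I → Form I := fun q => if F q = q.1.1 then q.2 else .top
  have hF : Pairwise fun a b => Disjoint (F a) (F b) := fun a b hab =>
    Finset.disjoint_left.2 fun i ha hb =>
      hab ((Finset.mem_filter.1 ha).2.symm.trans (Finset.mem_filter.1 hb).2)
  have hbox : ∀ q ∈ H.image p, w.1.HoldsBox (F q) (θ q) := by
    intro q hq
    obtain ⟨i, hi, rfl⟩ := Finset.mem_image.1 hq
    refine .inl ⟨⟨i, Finset.mem_filter.2 ⟨hi, rfl⟩⟩, ?_⟩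
    by_cases he : F (p i) = (p i).1.1
    · simp only [θ, he, if_true]
      exact (hp i hi).2.1
    · simp only [θ, he, if_false]
      refine RMVal.box_top_of_subset w.1 (fun j hj => ?_)
        (RMVal.box_mono w.1 (fun u _ => Form.evalP_top _) (hp i hi).2.1)
      obtain ⟨hj, hji⟩ := Finset.mem_filter.1 hj
      exact hji ▸ (hp j hj).1
  obtain ⟨χ, hχ, hχθ⟩ := RMVal.HoldsBox.exists_biUnion hF _ hbox
  have hU : (H.image p).biUnion F = H := by
    ext i
    simp only [Finset.mem_biUnion, Finset.mem_image, F, Finset.mem_filter]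
    exact ⟨fun ⟨_, _, h, _⟩ => h, fun h => ⟨p i, ⟨i, h, rfl⟩, h, rfl⟩⟩
  rw [hU] at hχ
  obtain ⟨_, hχ⟩ | ⟨rfl, -⟩ := hχ
  swap
  · simp at hH
  refine RMVal.box_mono w.1 (fun u hu => ?_) hχ
  -- For a box whose agents do not all use it, blame an agent that does not.
  have hf : ∀ q : BoxIndex I, ∃ i : { i // i ∈ q.1.1 }, (i : I) ∈ F q → q.1.1 ⊆ F q := by
    intro q
    by_cases hq : q.1.1 ⊆ F q
    · exact ⟨⟨_, q.1.2.choose_spec⟩, fun _ => hq⟩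
    · obtain ⟨i, hi, hn⟩ := Finset.not_subset.1 hq
      exact ⟨⟨i, hi⟩, fun h => (hn h).elim⟩
  choose f hf using hf
  have hmem : ((u, f) : CanonicalWorld I) ∈ ⋂ i ∈ H, Y i := by
    refine Set.mem_iInter₂.2 fun i hi => (hp i hi).2.2 fun hfi => ?_
    have hsub : (p i).1.1 ⊆ F (p i) := hf (p i) (by
      rw [show (f (p i) : I) = i from hfi]
      exact Finset.mem_filter.2 ⟨hi, rfl⟩)
    have he : F (p i) = (p i).1.1 := by
      refine Finset.Subset.antisymm (fun j hj => ?_) hsub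
      obtain ⟨hj, hji⟩ := Finset.mem_filter.1 hj
      exact hji ▸ (hp j hj).1
    simpa only [θ, he, if_true] using hχθ u hu (p i) (Finset.mem_image_of_mem p hi)
  rw [← hψ] at hmem
  exact hmem

theorem canonical_truth (φ : Form I) (w : CanonicalWorld I) :
    satN canonicalNbhd canonicalVal φ w ↔ evalP w.1.1 φ := by
  induction φ generalizing w with
  | atom n => rfl
  | bot => rfl
  | neg φ ih => simp only [satN, evalP, ih]
  | or φ ψ ih₁ ih₂ => simp only [satN, evalP, ih₁, ih₂]
  | box G hG φ ih =>
    simp only [satN, evalP, ih]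
    refine ⟨box_of_mem_ptwInter hG, fun h => ?_⟩
    exact ⟨contribution (⟨G, hG⟩, φ), fun i hi => ⟨(⟨G, hG⟩, φ), hi, h, subset_rfl⟩,
      (iInter_contribution (⟨G, hG⟩, φ)).symm⟩

end Canonical

/-- The base logic plus all instances of (RM_G) is sound and
strongly complete w.r.t. the class of all monotone models, i.e. models in
which each N_i(w) is closed under supersets. -/
theorem RM_sound_complete (I : Type) [DecidableEq I] :
    SoundComplete (BaseAx I ∪ RMAx I)
      (fun M : NbhModel I => ∀ (i : I) (w : M.W) (X Y : Set M.W),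
        X ∈ M.N i w → X ⊆ Y → Y ∈ M.N i w) := by
  intro Γ φ
  constructor
  · rintro ⟨l, hl, hp⟩ M hM w hw
    exact (satN_imp _ _ w _ _).1 (satN_of_prv M.V hM hp w)
      ((satN_foldr_and _ _ w l).2 fun ψ hψ => hw ψ (hl ψ hψ))
  · intro h
    by_contra hd
    obtain ⟨v, hΓ, hφ⟩ := exists_theoryVal hd
    let w : CanonicalWorld I := (v, fun q => ⟨_, q.1.2.choose_spec⟩)
    refine hφ ((canonical_truth φ w).1
      (h ⟨CanonicalWorld I, ⟨w⟩, canonicalNbhd, canonicalVal⟩ ?_ w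
        fun ψ hψ => (canonical_truth ψ w).2 (hΓ ψ hψ)))
    rintro i u X Y ⟨q, hi, hq, hX⟩ hXY
    exact ⟨q, hi, hq, hX.trans hXY⟩
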